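/- arXiv:1109.2415 — 3 statements merged into one kernel-verified Lean document; each statement's English description precedes it below -/
import Mathlib

section
/- (Proposition 1: Basic proximal-gradient method, convex case.) Consider the basic inexact proximal-gradient method (y_k = x_k): for each k ≥ 1, x_k is an ε_k-optimal solution of the proximal problem at x_{k-1} − (1/L)(g'(x_{k-1}) + e_k). Define A_k = Σ_{i=1}^k ( ‖e_i‖/L + √(2ε_i/L) ) and B_k = Σ_{i=1}^k ε_i/L. Then for all k ≥ 1, f( (1/k) Σ_{i=1}^k x_i ) − f(x*) ≤ (L/(2k)) ( ‖x_0 − x*‖ + 2A_k + √(2B_k) )². -/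
open scoped RealInnerProductSpace
open Finset

noncomputable section

variable {E : Type*} [NormedAddCommGroup E] [InnerProductSpace ℝ E] [CompleteSpace E]

/-- The ε-subdifferential of an `EReal`-valued function `a` at `x`:
the set of `y` such that `a t ≥ a x + ⟪y, t - x⟫ - ε` for all `t`. -/
def epsSubdiff (a : E → EReal) (ε : ℝ) (x : E) : Set E :=
  {y | ∀ t : E, a x + ((⟪y, t - x⟫ : ℝ) : EReal) - ((ε : ℝ) : EReal) ≤ a t}

/-- The objective function of the proximal problem at `y`. -/
def proxObj (L : ℝ) (h : E → EReal) (y x : E) : EReal :=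
  ((L / 2 * ‖x - y‖ ^ 2 : ℝ) : EReal) + h x

/-- `x` is an `ε`-optimal solution of the proximal problem at `y`. -/
def IsEpsOptimal (L : ℝ) (h : E → EReal) (ε : ℝ) (y x : E) : Prop :=
  proxObj L h y x ≤ ((ε : ℝ) : EReal) + ⨅ z : E, proxObj L h y z

/-- Convexity for `EReal`-valued functions. -/
def ERealConvexOn (h : E → EReal) : Prop :=
  ∀ x y : E, ∀ a b : ℝ, 0 ≤ a → 0 ≤ b → a + b = 1 →
    h (a • x + b • y) ≤ ((a : ℝ) : EReal) * h x + ((b : ℝ) : EReal) * h y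

theorem hasDerivAt_comp_lineMap {g : E → ℝ} {v w z : E} {t : ℝ}
    (hv : HasGradientAt g v (AffineMap.lineMap w z t)) :
    HasDerivAt (fun t : ℝ => g (AffineMap.lineMap w z t)) ⟪v, z - w⟫ t :=
  (hv.hasFDerivAt.comp_hasDerivAt t AffineMap.hasDerivAt_lineMap).congr_deriv (by simp)

/-- First-order lower bound for a differentiable convex function. -/
theorem ConvexOn.le_add_inner_gradient {g : E → ℝ} {v w : E} (hg : ConvexOn ℝ Set.univ g)
    (hv : HasGradientAt g v w) (z : E) : g w + ⟪v, z - w⟫ ≤ g z := by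
  have hφ : ConvexOn ℝ Set.univ (fun t : ℝ => g (AffineMap.lineMap w z t)) :=
    hg.comp_affineMap (AffineMap.lineMap w z)
  have hd : HasDerivAt (fun t : ℝ => g (AffineMap.lineMap w z t)) ⟪v, z - w⟫ 0 := by
    simpa using hasDerivAt_comp_lineMap (w := w) (z := z) (t := 0) (by simpa using hv)
  have := hφ.le_slope_of_hasDerivAt (Set.mem_univ _) (Set.mem_univ _) one_pos hd
  simp only [slope_def_field, AffineMap.lineMap_apply_one, AffineMap.lineMap_apply_zero, sub_zero,
    div_one] at this
  linarith

/-- The descent lemma for a function with Lipschitz continuous gradient. -/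
theorem le_add_inner_gradient_add_sq {L : ℝ} {g : E → ℝ} {g' : E → E}
    (hgrad : ∀ w, HasGradientAt g (g' w) w) (hlip : ∀ w w', ‖g' w - g' w'‖ ≤ L * ‖w - w'‖)
    (w z : E) : g z ≤ g w + ⟪g' w, z - w⟫ + L / 2 * ‖z - w‖ ^ 2 := by
  have hd : ∀ t : ℝ, HasDerivAt
      (fun t : ℝ => g (AffineMap.lineMap w z t)
        - (t * ⟪g' w, z - w⟫ + L / 2 * ‖z - w‖ ^ 2 * t ^ 2))
      (⟪g' (AffineMap.lineMap w z t), z - w⟫ - (⟪g' w, z - w⟫ + L * ‖z - w‖ ^ 2 * t)) t := by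
    intro t
    have h1 : HasDerivAt (fun t : ℝ => g (AffineMap.lineMap w z t))
        ⟪g' (AffineMap.lineMap w z t), z - w⟫ t := hasDerivAt_comp_lineMap (hgrad _)
    refine (h1.sub (((hasDerivAt_id t).mul_const _).add
      ((hasDerivAt_pow 2 t).const_mul (L / 2 * ‖z - w‖ ^ 2)))).congr_deriv ?_
    simp only [Nat.cast_ofNat]
    ring
  have hanti := antitoneOn_of_hasDerivWithinAt_nonpos (convex_Icc (0 : ℝ) 1)
    (fun t _ => (hd t).continuousAt.continuousWithinAt)
    (fun t _ => (hd t).hasDerivWithinAt) (fun t ht => by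
      rw [interior_Icc] at ht
      have h1 : ⟪g' (AffineMap.lineMap w z t) - g' w, z - w⟫
          ≤ L * ‖AffineMap.lineMap w z t - w‖ * ‖z - w‖ :=
        (real_inner_le_norm _ _).trans
          (mul_le_mul_of_nonneg_right (hlip _ _) (norm_nonneg _))
      have h2 : ‖AffineMap.lineMap w z t - w‖ = t * ‖z - w‖ := by
        rw [← dist_eq_norm, dist_lineMap_left, dist_eq_norm, norm_sub_rev w z,
          Real.norm_of_nonneg ht.1.le]
      rw [h2, inner_sub_left] at h1
      linarith)
  have := hanti (Set.left_mem_Icc.2 zero_le_one) (Set.right_mem_Icc.2 zero_le_one) zero_le_one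
  simp only [AffineMap.lineMap_apply_one, AffineMap.lineMap_apply_zero] at this
  linarith

/-- The real part of a convex `EReal`-valued function is convex on its effective domain. -/
theorem ERealConvexOn.convexOn_toReal {F : Type*} [NormedAddCommGroup F] [InnerProductSpace ℝ F]
    {h : F → EReal} (hh : ERealConvexOn h) (hbot : ∀ w, h w ≠ ⊥) :
    ConvexOn ℝ {w | h w ≠ ⊤} (fun w => (h w).toReal) := by
  have key : ∀ u, h u ≠ ⊤ → ∀ v, h v ≠ ⊤ → ∀ a b : ℝ, 0 ≤ a → 0 ≤ b → a + b = 1 →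
      h (a • u + b • v) ≤ ((a * (h u).toReal + b * (h v).toReal : ℝ) : EReal) := by
    intro u hu v hv a b ha hb hab
    rw [EReal.coe_add, EReal.coe_mul, EReal.coe_mul, EReal.coe_toReal hu (hbot u),
      EReal.coe_toReal hv (hbot v)]
    exact hh u v a b ha hb hab
  refine ⟨fun u hu v hv a b ha hb hab => ?_, fun u hu v hv a b ha hb hab => ?_⟩
  · exact ne_top_of_le_ne_top (EReal.coe_ne_top _) (key u hu v hv a b ha hb hab)
  · exact EReal.toReal_le_toReal (key u hu v hv a b ha hb hab) (hbot _) (EReal.coe_ne_top _)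

theorem IsEpsOptimal.le_add {F : Type*} [NormedAddCommGroup F] [InnerProductSpace ℝ F]
    {L ε : ℝ} {h : F → EReal} {y u : F} (hu : IsEpsOptimal L h ε y u) (z : F) :
    ((L / 2 * ‖u - y‖ ^ 2 : ℝ) : EReal) + h u
      ≤ ((ε + L / 2 * ‖z - y‖ ^ 2 : ℝ) : EReal) + h z := by
  rw [EReal.coe_add, add_assoc]
  exact le_trans hu (add_le_add_right (iInf_le _ z) _)

theorem IsEpsOptimal.ne_top {F : Type*} [NormedAddCommGroup F] [InnerProductSpace ℝ F]
    {L ε : ℝ} {h : F → EReal} {y u z : F} (hu : IsEpsOptimal L h ε y u) (hz : h z ≠ ⊤) :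
    h u ≠ ⊤ := by
  intro htop
  have := hu.le_add z
  rw [htop, EReal.coe_add_top, top_le_iff] at this
  exact EReal.add_ne_top (EReal.coe_ne_top _) hz this

theorem IsEpsOptimal.toReal_le {F : Type*} [NormedAddCommGroup F] [InnerProductSpace ℝ F]
    {L ε : ℝ} {h : F → EReal} {y u z : F} (hbot : ∀ w, h w ≠ ⊥) (hu : IsEpsOptimal L h ε y u)
    (hz : h z ≠ ⊤) :
    L / 2 * ‖u - y‖ ^ 2 + (h u).toReal ≤ ε + L / 2 * ‖z - y‖ ^ 2 + (h z).toReal := by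
  have := hu.le_add z
  rw [← EReal.coe_toReal hz (hbot z), ← EReal.coe_toReal (hu.ne_top hz) (hbot u)] at this
  exact_mod_cast this

theorem le_add_mul_sqrt_of_forall_mul_le {c ε L D : ℝ} (hL : 0 < L) (hε : 0 ≤ ε) (hD : 0 ≤ D)
    (hs : ∀ s, 0 < s → s ≤ 1 → s * c ≤ ε + L / 2 * s ^ 2 * D ^ 2) :
    c ≤ ε + L * √(2 * ε / L) * D := by
  set r := √(2 * ε / L) with hr
  have hr0 : 0 ≤ r := Real.sqrt_nonneg _
  have hεr : ε = L / 2 * r ^ 2 := by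
    rw [hr, Real.sq_sqrt (by positivity)]
    field_simp
  rcases le_or_gt D r with hDr | hrD
  · have h1 := hs 1 one_pos le_rfl
    have h2 : L * D * D ≤ L * D * r := mul_le_mul_of_nonneg_left hDr (by positivity)
    have h3 : 0 ≤ L * D * r := by positivity
    nlinarith
  have hD0 : 0 < D := hr0.trans_lt hrD
  rcases hr0.eq_or_lt with h0 | hrpos
  · rw [← h0] at hεr ⊢
    by_contra! hc
    have hc0 : 0 < c := by nlinarith
    have hLD : 0 < L * D ^ 2 := by positivity
    have hm0 : 0 < min 1 (c / (L * D ^ 2)) := lt_min one_pos (by positivity)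
    have h1 := hs _ hm0 (min_le_left _ _)
    have h2 : min 1 (c / (L * D ^ 2)) * (L * D ^ 2) ≤ c :=
      (le_div_iff₀ hLD).1 (min_le_right _ _)
    generalize min 1 (c / (L * D ^ 2)) = m at *
    have h3 := mul_le_mul_of_nonneg_left h2 hm0.le
    have h4 := mul_pos hm0 hc0
    nlinarith
  · have h1 := hs (r / D) (by positivity) ((div_le_one hD0).2 hrD.le)
    have h2 : L / 2 * (r / D) ^ 2 * D ^ 2 = L / 2 * r ^ 2 := by field_simp
    rw [h2, hεr] at h1
    have h3 : r / D * c ≤ r / D * (L * r * D) := by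
      have : r / D * (L * r * D) = L * r ^ 2 := by field_simp
      linarith
    have := le_of_mul_le_mul_left h3 (by positivity)
    linarith

/-- An `ε`-optimal solution of a proximal problem satisfies an approximate subgradient inequality
at every point of the domain. -/
theorem IsEpsOptimal.toReal_sub_le {F : Type*} [NormedAddCommGroup F] [InnerProductSpace ℝ F]
    {L ε : ℝ} {h : F → EReal} {y u z : F} (hL : 0 < L) (hε : 0 ≤ ε) (hh : ERealConvexOn h)
    (hbot : ∀ w, h w ≠ ⊥) (hu : IsEpsOptimal L h ε y u) (hz : h z ≠ ⊤) :
    (h u).toReal - (h z).toReal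
      ≤ L * ⟪u - y, z - u⟫ + (ε + L * √(2 * ε / L) * ‖u - z‖) := by
  rw [← sub_le_iff_le_add']
  refine le_add_mul_sqrt_of_forall_mul_le hL hε (norm_nonneg _) fun s hs0 hs1 => ?_
  have hconv := hh.convexOn_toReal hbot
  have hu' := hu.ne_top hz
  have hmem : h ((1 - s) • u + s • z) ≠ ⊤ := hconv.1 hu' hz (by linarith) hs0.le (by ring)
  have h1 := hconv.2 hu' hz (show 0 ≤ 1 - s by linarith) hs0.le (by ring)
  have h2 := hu.toReal_le hbot hmem
  have h3 : ‖(1 - s) • u + s • z - y‖ ^ 2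
      = ‖u - y‖ ^ 2 + 2 * s * ⟪u - y, z - u⟫ + s ^ 2 * ‖u - z‖ ^ 2 := by
    rw [show (1 - s) • u + s • z - y = (u - y) + s • (z - u) by module, norm_add_sq_real,
      inner_smul_right, norm_smul, mul_pow, Real.norm_eq_abs, sq_abs, norm_sub_rev z u]
    ring
  rw [h3] at h2
  simp only [smul_eq_mul] at h1
  linarith

theorem sum_le_sq_of_recurrence {D a b δ : ℕ → ℝ} (hD : ∀ i, 0 ≤ D i) (ha : ∀ i, 0 ≤ a i)
    (hb : ∀ i, 0 ≤ b i) (hδ : ∀ i, 1 ≤ i → 0 ≤ δ i)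
    (hrec : ∀ i, 1 ≤ i → δ i + D i ^ 2 ≤ D (i - 1) ^ 2 + 2 * (a i * D i) + 2 * b i) (k : ℕ) :
    ∑ i ∈ Icc 1 k, δ i
      ≤ (D 0 + 2 * ∑ i ∈ Icc 1 k, a i + √(2 * ∑ i ∈ Icc 1 k, b i)) ^ 2 := by
  have hsum : ∀ n, ∑ i ∈ Icc 1 n, δ i + D n ^ 2
      ≤ D 0 ^ 2 + 2 * ∑ i ∈ Icc 1 n, a i * D i + 2 * ∑ i ∈ Icc 1 n, b i := by
    intro n
    induction n with
    | zero => simp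
    | succ n ih =>
      have := hrec (n + 1) (by omega)
      rw [Nat.add_sub_cancel] at this
      simp only [sum_Icc_succ_top (Nat.le_add_left 1 n)]
      linarith
  set A := ∑ i ∈ Icc 1 k, a i with hA
  set B := ∑ i ∈ Icc 1 k, b i with hB
  have hA0 : 0 ≤ A := sum_nonneg fun i _ => ha i
  have hB0 : 0 ≤ B := sum_nonneg fun i _ => hb i
  obtain ⟨m, hm, hmax⟩ := exists_max_image (range (k + 1)) D ⟨0, by simp⟩
  have hmk : m ≤ k := by simpa [Nat.lt_succ_iff] using hm
  have hbound : ∀ n ≤ k, ∑ i ∈ Icc 1 n, δ i + D n ^ 2 ≤ D 0 ^ 2 + 2 * (A * D m) + 2 * B := by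
    intro n hn
    have hsub : Icc 1 n ⊆ Icc 1 k := Icc_subset_Icc_right hn
    have h1 : ∑ i ∈ Icc 1 n, a i * D i ≤ A * D m := by
      rw [hA, sum_mul]
      refine (sum_le_sum_of_subset_of_nonneg hsub
        fun i _ _ => mul_nonneg (ha i) (hD i)).trans (sum_le_sum fun i hi => ?_)
      rw [mem_Icc] at hi
      exact mul_le_mul_of_nonneg_left (hmax i (by simp; omega)) (ha i)
    have h2 : ∑ i ∈ Icc 1 n, b i ≤ B := sum_le_sum_of_subset_of_nonneg hsub fun i _ _ => hb i
    linarith [hsum n]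
  set q := √(2 * B) with hq
  have hq0 : 0 ≤ q := Real.sqrt_nonneg _
  have hqB : q ^ 2 = 2 * B := Real.sq_sqrt (by positivity)
  have hD0 := hD 0
  have hDm := hD m
  have hcross : 0 ≤ D 0 * q := by positivity
  have hM : D m ≤ 2 * A + (D 0 + q) := by
    have h1 := hbound m hmk
    have h2 : 0 ≤ ∑ i ∈ Icc 1 m, δ i := sum_nonneg fun i hi => hδ i (mem_Icc.1 hi).1
    by_contra! hlt
    have h3 : (D 0 + q) * D m ≤ (D m - 2 * A) * D m :=
      mul_le_mul_of_nonneg_right (by linarith) hDm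
    nlinarith
  have h1 := hbound k le_rfl
  have h2 := mul_le_mul_of_nonneg_left hM hA0
  have h3 : 0 ≤ A * (D 0 + q) := by positivity
  nlinarith [sq_nonneg (D k)]

/-- One step of the inexact proximal-gradient method. -/
theorem inexact_proximal_gradient_step {L ε : ℝ} (hL : 0 < L) (hε : 0 ≤ ε)
    {g : E → ℝ} {g' : E → E} (hgconv : ConvexOn ℝ Set.univ g)
    (hgrad : ∀ w, HasGradientAt g (g' w) w) (hlip : ∀ w w', ‖g' w - g' w'‖ ≤ L * ‖w - w'‖)
    {h : E → EReal} (hh : ERealConvexOn h) (hbot : ∀ w, h w ≠ ⊥) {u v e z : E}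
    (hz : h z ≠ ⊤) (hv : IsEpsOptimal L h ε (u - (1 / L) • (g' u + e)) v) :
    2 / L * ((g v + (h v).toReal) - (g z + (h z).toReal)) + ‖v - z‖ ^ 2
      ≤ ‖u - z‖ ^ 2 + 2 * ((‖e‖ / L + √(2 * ε / L)) * ‖v - z‖) + 2 * (ε / L) := by
  have h1 := hv.toReal_sub_le hL hε hh hbot hz
  have h2 := le_add_inner_gradient_add_sq hgrad hlip u v
  have h3 := hgconv.le_add_inner_gradient (hgrad u) z
  have h4 : ⟪e, z - v⟫ ≤ ‖e‖ * ‖v - z‖ := by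
    rw [norm_sub_rev v z]
    exact real_inner_le_norm _ _
  have h5 : L * ⟪v - (u - (1 / L) • (g' u + e)), z - v⟫
      = L * ⟪v - u, z - v⟫ + ⟪g' u, z - v⟫ + ⟪e, z - v⟫ := by
    rw [show v - (u - (1 / L) • (g' u + e)) = (v - u) + (1 / L) • (g' u + e) by abel,
      inner_add_left, inner_smul_left, inner_add_left, RCLike.conj_to_real]
    field_simp
    ring
  have h6 : ⟪g' u, z - u⟫ = ⟪g' u, z - v⟫ + ⟪g' u, v - u⟫ := by
    rw [← inner_add_right, sub_add_sub_cancel]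
  have h7 : ‖u - z‖ ^ 2 = ‖v - u‖ ^ 2 + 2 * ⟪v - u, z - v⟫ + ‖v - z‖ ^ 2 := by
    rw [norm_sub_rev u z, norm_sub_rev v z, ← norm_add_sq_real]
    congr 2
    abel
  rw [h5] at h1
  have h8 : (g v + (h v).toReal) - (g z + (h z).toReal) ≤ L / 2 * (‖u - z‖ ^ 2 - ‖v - z‖ ^ 2)
      + ‖e‖ * ‖v - z‖ + L * √(2 * ε / L) * ‖v - z‖ + ε := by
    rw [h7]
    linarith
  have h9 := mul_le_mul_of_nonneg_left h8 (show 0 ≤ 2 / L by positivity)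
  have h10 : 2 / L * (L / 2 * (‖u - z‖ ^ 2 - ‖v - z‖ ^ 2)
      + ‖e‖ * ‖v - z‖ + L * √(2 * ε / L) * ‖v - z‖ + ε) = ‖u - z‖ ^ 2 - ‖v - z‖ ^ 2
      + 2 * ((‖e‖ / L + √(2 * ε / L)) * ‖v - z‖) + 2 * (ε / L) := by
    field_simp
    ring
  linarith

theorem stmt_5
    (L : ℝ) (hL : 0 < L)
    (g : E → ℝ) (g' : E → E)
    (hgconv : ConvexOn ℝ Set.univ g)
    (hgrad : ∀ w, HasGradientAt g (g' w) w)
    (hlip : ∀ w w', ‖g' w - g' w'‖ ≤ L * ‖w - w'‖)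
    (h : E → EReal)
    (hhconv : ERealConvexOn h)
    (hhlsc : LowerSemicontinuous h)
    (hhproper : ∃ w, h w ≠ ⊤) (hhnbot : ∀ w, h w ≠ ⊥)
    (f : E → EReal) (hf : ∀ w, f w = ((g w : ℝ) : EReal) + h w)
    (xstar : E) (hmin : ∀ w, f xstar ≤ f w)
    (x e : ℕ → E) (ε : ℕ → ℝ) (hεnn : ∀ k, 0 ≤ ε k)
    (hstep : ∀ k, 1 ≤ k →
      IsEpsOptimal L h (ε k) (x (k - 1) - (1 / L) • (g' (x (k - 1)) + e k)) (x k))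
    (A B : ℕ → ℝ)
    (hA : ∀ k, A k = ∑ i ∈ Icc 1 k, (‖e i‖ / L + Real.sqrt (2 * ε i / L)))
    (hB : ∀ k, B k = ∑ i ∈ Icc 1 k, ε i / L)
    :
    ∀ k : ℕ, 1 ≤ k →
      f ((1 / (k : ℝ)) • ∑ i ∈ Icc 1 k, x i) - f xstar ≤
        ((L / (2 * (k : ℝ)) *
          (‖x 0 - xstar‖ + 2 * A k + Real.sqrt (2 * B k)) ^ 2 : ℝ) : EReal) := by
  intro k hk
  obtain ⟨w₀, hw₀⟩ := hhproper
  have hstar : h xstar ≠ ⊤ := by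
    intro htop
    have := hmin w₀
    rw [hf, hf, htop, EReal.coe_add_top, top_le_iff] at this
    exact EReal.add_ne_top (EReal.coe_ne_top _) hw₀ this
  have hx : ∀ i, 1 ≤ i → h (x i) ≠ ⊤ := fun i hi => (hstep i hi).ne_top hstar
  have hfr : ∀ w, h w ≠ ⊤ → f w = ((g w + (h w).toReal : ℝ) : EReal) := by
    intro w hw
    rw [hf, EReal.coe_add, EReal.coe_toReal hw (hhnbot w)]
  have hconv : ConvexOn ℝ {w | h w ≠ ⊤} (fun w => g w + (h w).toReal) :=
    (hgconv.subset (Set.subset_univ _) (hhconv.convexOn_toReal hhnbot).1).add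
      (hhconv.convexOn_toReal hhnbot)
  have hk0 : (0 : ℝ) < k := by exact_mod_cast hk
  have hw1 : ∑ _i ∈ Icc 1 k, (1 / (k : ℝ)) = 1 := by
    simp [hk0.ne']
  have hxmem : ∀ i ∈ Icc 1 k, x i ∈ {w | h w ≠ ⊤} := fun i hi => hx i (mem_Icc.1 hi).1
  have hmem := hconv.1.sum_mem (fun _ _ => by positivity) hw1 hxmem
  have hjensen := hconv.map_sum_le (fun _ _ => by positivity) hw1 hxmem
  rw [← smul_sum] at hmem hjensen
  rw [← smul_sum, smul_eq_mul] at hjensen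
  have hδ : ∀ i, 1 ≤ i →
      0 ≤ 2 / L * ((g (x i) + (h (x i)).toReal) - (g xstar + (h xstar).toReal)) := by
    intro i hi
    have := hmin (x i)
    rw [hfr _ hstar, hfr _ (hx i hi), EReal.coe_le_coe_iff] at this
    exact mul_nonneg (by positivity) (sub_nonneg.2 this)
  have hsum := sum_le_sq_of_recurrence (D := fun i => ‖x i - xstar‖)
    (fun i => norm_nonneg _)
    (fun i => add_nonneg (div_nonneg (norm_nonneg (e i)) hL.le) (Real.sqrt_nonneg (2 * ε i / L)))
    (fun i => div_nonneg (hεnn i) hL.le) hδ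
    (fun i hi => inexact_proximal_gradient_step hL (hεnn i) hgconv hgrad hlip hhconv hhnbot hstar
      (hstep i hi)) k
  rw [← hA, ← hB, ← mul_sum, sum_sub_distrib, sum_const, Nat.card_Icc, Nat.add_sub_cancel,
    nsmul_eq_mul] at hsum
  rw [hfr _ hmem, hfr _ hstar, ← EReal.coe_sub, EReal.coe_le_coe_iff]
  refine (sub_le_sub_right hjensen _).trans ?_
  refine le_trans (le_of_eq ?_)
    (mul_le_mul_of_nonneg_left hsum (show 0 ≤ L / (2 * (k : ℝ)) by positivity))
  field_simp
end
end

section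
/- Consider the accelerated inexact proximal-gradient method: y_k = x_k + ((k−1)/(k+2))(x_k − x_{k-1}) with y_0 = x_0, and for each k ≥ 1, x_k is an ε_k-optimal solution of the proximal problem at y_{k-1} − (1/L)(g'(y_{k-1}) + e_k). Define θ_k = 2/(k+1) and v_k = x_{k-1} + (1/θ_k)(x_k − x_{k-1}). Then for each k ≥ 1 there exists f_k ∈ E with ‖f_k‖ ≤ √(2ε_k/L) such that (1/θ_k²)(f(x_k) − f(x*)) + (L/2)‖v_k − x*‖² ≤ ((1 − θ_k)/θ_k²)(f(x_{k-1}) − f(x*)) + (L/2)‖v_{k-1} − x*‖² + ε_k/θ_k² + (1/θ_k)⟨e_k + L f_k, x* − v_k⟩. -/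
open scoped RealInnerProductSpace
open Finset

noncomputable section

variable {E : Type*} [NormedAddCommGroup E] [InnerProductSpace ℝ E] [CompleteSpace E]

theorem HasGradientAt.hasDerivAt_comp_line {g : E → ℝ} {G w d : E} {s : ℝ}
    (hg : HasGradientAt g G (w + s • d)) :
    HasDerivAt (fun r : ℝ => g (w + r • d)) ⟪G, d⟫ s := by
  have hline : HasDerivAt (fun r : ℝ => w + r • d) d s := by
    simpa using ((hasDerivAt_id s).smul_const d).const_add w
  simpa [Function.comp_def] using hg.hasFDerivAt.comp_hasDerivAt s hline

/-- A differentiable convex function lies above its tangent planes. -/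
theorem ConvexOn.add_inner_gradient_le {g : E → ℝ} (hgconv : ConvexOn ℝ Set.univ g) {G w : E}
    (hG : HasGradientAt g G w) (t : E) : g w + ⟪G, t - w⟫ ≤ g t := by
  have hconv : ConvexOn ℝ Set.univ (fun r : ℝ => g (w + r • (t - w))) := by
    have := hgconv.comp_affineMap (AffineMap.lineMap w t : ℝ →ᵃ[ℝ] E)
    simpa [Function.comp_def, AffineMap.lineMap_apply, add_comm] using this
  have hderiv : HasDerivAt (fun r : ℝ => g (w + r • (t - w))) ⟪G, t - w⟫ 0 :=
    HasGradientAt.hasDerivAt_comp_line (by simpa using hG)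
  have := hconv.le_slope_of_hasDerivAt (Set.mem_univ 0) (Set.mem_univ 1) one_pos hderiv
  simp [slope_def_field] at this
  linarith

/-- The descent lemma: the quadratic upper bound for a function with Lipschitz gradient. -/
theorem le_quadratic_of_lipschitz_gradient {g : E → ℝ} {g' : E → E} {L : ℝ}
    (hgrad : ∀ w, HasGradientAt g (g' w) w)
    (hlip : ∀ w w', ‖g' w - g' w'‖ ≤ L * ‖w - w'‖) (w t : E) :
    g t ≤ g w + ⟪g' w, t - w⟫ + L / 2 * ‖t - w‖ ^ 2 := by
  set d := t - w with hd
  have hderiv (s : ℝ) :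
      HasDerivAt (fun r : ℝ => g (w + r • d) - r * ⟪g' w, d⟫ - r ^ 2 * (L / 2 * ‖d‖ ^ 2))
        (⟪g' (w + s • d), d⟫ - ⟪g' w, d⟫ - 2 * s * (L / 2 * ‖d‖ ^ 2)) s := by
    have h1 := (hgrad (w + s • d)).hasDerivAt_comp_line
    have h2 := (hasDerivAt_id s).mul_const ⟪g' w, d⟫
    have h3 := ((hasDerivAt_id s).pow 2).mul_const (L / 2 * ‖d‖ ^ 2)
    simpa [Pi.sub_def] using (h1.sub h2).sub h3
  have hanti := antitoneOn_of_deriv_nonpos (convex_Icc (0 : ℝ) 1)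
    (fun s _ => (hderiv s).continuousAt.continuousWithinAt)
    (fun s _ => (hderiv s).differentiableAt.differentiableWithinAt) (fun s hs => by
      rw [interior_Icc] at hs
      rw [(hderiv s).deriv, ← inner_sub_left]
      have h1 := real_inner_le_norm (g' (w + s • d) - g' w) d
      have h2 := hlip (w + s • d) w
      rw [add_sub_cancel_left, norm_smul, Real.norm_of_nonneg hs.1.le] at h2
      nlinarith [mul_le_mul_of_nonneg_right h2 (norm_nonneg d)])
  have := hanti (Set.left_mem_Icc.2 zero_le_one) (Set.right_mem_Icc.2 zero_le_one) zero_le_one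
  simp [hd] at this
  linarith

theorem ERealConvexOn.le_coe_of_le_coe {F : Type*} [NormedAddCommGroup F] [InnerProductSpace ℝ F]
    {h : F → EReal} (hh : ERealConvexOn h) {x y : F} {r s a b : ℝ} (hx : h x ≤ r) (hy : h y ≤ s)
    (ha : 0 ≤ a) (hb : 0 ≤ b) (hab : a + b = 1) :
    h (a • x + b • y) ≤ ((a * r + b * s : ℝ) : EReal) := by
  refine (hh x y a b ha hb hab).trans ?_
  push_cast
  exact add_le_add (mul_le_mul_of_nonneg_left hx (EReal.coe_nonneg.2 ha))
    (mul_le_mul_of_nonneg_left hy (EReal.coe_nonneg.2 hb))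

/-- A proximal objective that is bounded below attains its minimum. The pairs `(t, s)` with
`h t ≤ s` range over the epigraph of `h`. -/
theorem exists_proximal_minimizer {h : E → EReal} (hhconv : ERealConvexOn h)
    (hhlsc : LowerSemicontinuous h) {L : ℝ} (hL : 0 < L) {z x₀ : E} {r₀ : ℝ} (hx₀ : h x₀ ≤ r₀)
    {c : ℝ} (hc : ∀ (t : E) (s : ℝ), h t ≤ s → c ≤ L / 2 * ‖t - z‖ ^ 2 + s) :
    ∃ (p : E) (r : ℝ), h p ≤ r ∧
      ∀ (t : E) (s : ℝ), h t ≤ s → L / 2 * ‖p - z‖ ^ 2 + r ≤ L / 2 * ‖t - z‖ ^ 2 + s := by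
  set A : Set ℝ := {q | ∃ (t : E) (s : ℝ), h t ≤ s ∧ L / 2 * ‖t - z‖ ^ 2 + s = q}
  have hAne : A.Nonempty := ⟨_, x₀, r₀, hx₀, rfl⟩
  have hAbdd : BddBelow A := ⟨c, by rintro _ ⟨t, s, hts, rfl⟩; exact hc t s hts⟩
  set m := sInf A
  have hm (t : E) (s : ℝ) (hts : h t ≤ s) : m ≤ L / 2 * ‖t - z‖ ^ 2 + s :=
    csInf_le hAbdd ⟨t, s, hts, rfl⟩
  have happrox (n : ℕ) : ∃ (t : E) (s : ℝ), h t ≤ s ∧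
      L / 2 * ‖t - z‖ ^ 2 + s < m + 1 / ((n : ℝ) + 1) := by
    obtain ⟨_, ⟨t, s, hts, rfl⟩, hlt⟩ :=
      exists_lt_of_csInf_lt hAne (lt_add_of_pos_right m (Nat.one_div_pos_of_nat (n := n)))
    exact ⟨t, s, hts, hlt⟩
  choose u r hur hum using happrox
  have hdist (n k : ℕ) (hnk : n ≤ k) :
      dist (u n) (u k) ≤ Real.sqrt (8 / L * (1 / ((n : ℝ) + 1))) := by
    have hmid := hm _ _ (hhconv.le_coe_of_le_coe (hur n) (hur k) (by norm_num : (0 : ℝ) ≤ 1 / 2)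
      (by norm_num : (0 : ℝ) ≤ 1 / 2) (by norm_num))
    have hpar := parallelogram_law_with_norm ℝ (u n - z) (u k - z)
    have hsum : (u n - z) + (u k - z)
        = (2 : ℝ) • ((1 / 2 : ℝ) • u n + (1 / 2 : ℝ) • u k - z) := by module
    rw [sub_sub_sub_cancel_right, hsum, norm_smul, Real.norm_two] at hpar
    have hmono := Nat.one_div_le_one_div (α := ℝ) hnk
    have hn := hum n
    have hk := hum k
    rw [dist_eq_norm]
    apply Real.le_sqrt_of_sq_le
    rw [div_mul_eq_mul_div, le_div_iff₀ hL]
    nlinarith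
  have hlim0 : Filter.Tendsto (fun n : ℕ => 1 / ((n : ℝ) + 1)) Filter.atTop (nhds 0) :=
    tendsto_one_div_add_atTop_nhds_zero_nat
  have hcauchy : CauchySeq u := cauchySeq_of_le_tendsto_0' _ hdist (by
    simpa using (hlim0.const_mul (8 / L)).sqrt)
  obtain ⟨p, hp⟩ := cauchySeq_tendsto_of_complete hcauchy
  refine ⟨p, m - L / 2 * ‖p - z‖ ^ 2, ?_, fun t s hts => by simpa using hm t s hts⟩
  have hlim : Filter.Tendsto
      (fun n : ℕ => m + 1 / ((n : ℝ) + 1) - L / 2 * ‖u n - z‖ ^ 2) Filter.atTop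
      (nhds (m - L / 2 * ‖p - z‖ ^ 2)) := by
    simpa using (hlim0.const_add m).sub ((((hp.sub_const z).norm).pow 2).const_mul (L / 2))
  have hepi := lowerSemicontinuous_iff_isClosed_epigraph.1 hhlsc
  refine hepi.mem_of_tendsto (hp.prodMk_nhds ((continuous_coe_real_ereal.tendsto _).comp hlim))
    (Filter.Eventually.of_forall fun n => ?_)
  refine (hur n).trans (EReal.coe_le_coe_iff.2 ?_)
  linarith [hum n]

/-- First-order optimality: a minimizer `p` of the proximal objective at `z` satisfies
`L • (z - p) ∈ ∂h(p)`. -/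
theorem proximal_minimizer_subgradient {F : Type*} [NormedAddCommGroup F] [InnerProductSpace ℝ F]
    {h : F → EReal} (hhconv : ERealConvexOn h) {L : ℝ} {z p : F} {r : ℝ} (hp : h p ≤ r)
    (hmin : ∀ (t : F) (s : ℝ), h t ≤ s → L / 2 * ‖p - z‖ ^ 2 + r ≤ L / 2 * ‖t - z‖ ^ 2 + s)
    {t : F} {s : ℝ} (hts : h t ≤ s) : r + L * ⟪z - p, t - p⟫ ≤ s := by
  have hseg (a : ℝ) (ha : a ∈ Set.Ioo (0 : ℝ) 1) :
      r + L * ⟪z - p, t - p⟫ ≤ s + a * (L / 2 * ‖t - p‖ ^ 2) := by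
    have hconv := hmin _ _ (hhconv.le_coe_of_le_coe hp hts (sub_nonneg.2 ha.2.le) ha.1.le
      (sub_add_cancel 1 a))
    have hsplit : (1 - a) • p + a • t - z = a • (t - p) - (z - p) := by module
    rw [hsplit, norm_sub_sq_real (a • (t - p)), norm_smul, real_inner_smul_left,
      Real.norm_of_nonneg ha.1.le, norm_sub_rev p z, real_inner_comm] at hconv
    refine le_of_mul_le_mul_left ?_ ha.1
    nlinarith
  have hlim : Filter.Tendsto (fun a : ℝ => s + a * (L / 2 * ‖t - p‖ ^ 2))
      (nhdsWithin 0 (Set.Ioi 0)) (nhds s) := by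
    have : Continuous fun a : ℝ => s + a * (L / 2 * ‖t - p‖ ^ 2) := by fun_prop
    simpa using (this.tendsto 0).mono_left nhdsWithin_le_nhds
  exact ge_of_tendsto hlim (Filter.eventually_of_mem (Ioo_mem_nhdsGT one_pos) hseg)

/-- An `ε`-optimal point `x` of the proximal problem at `z` has `h x` finite, and
`L • (z - x - q)` is an `ε`-subgradient of `h` at `x` for some `q` of norm at most `√(2ε/L)`. -/
theorem IsEpsOptimal.exists_epsSubgradient {h : E → EReal} (hhconv : ERealConvexOn h)
    (hhlsc : LowerSemicontinuous h) (hhproper : ∃ w, h w ≠ ⊤) (hhnbot : ∀ w, h w ≠ ⊥)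
    {L : ℝ} (hL : 0 < L) {ε : ℝ} {z x : E} (hx : IsEpsOptimal L h ε z x) :
    ∃ b : ℝ, h x = b ∧ ∃ q : E, ‖q‖ ≤ Real.sqrt (2 * ε / L) ∧
      ∀ (t : E) (s : ℝ), h t ≤ s → b + L * ⟪z - x - q, t - x⟫ - ε ≤ s := by
  have hopt (t : E) (s : ℝ) (hts : h t ≤ s) :
      ((L / 2 * ‖x - z‖ ^ 2 : ℝ) : EReal) + h x ≤
        ((ε + (L / 2 * ‖t - z‖ ^ 2 + s) : ℝ) : EReal) := by
    refine hx.trans ?_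
    push_cast
    refine add_le_add le_rfl ((iInf_le _ t).trans ?_)
    exact add_le_add (by push_cast; exact le_rfl) hts
  obtain ⟨w, hw⟩ := hhproper
  have hwle : h w ≤ ((h w).toReal : EReal) := EReal.le_coe_toReal hw
  have hxtop : h x ≠ ⊤ := fun htop => by
    have := hopt w _ hwle
    rw [htop, EReal.coe_add_top] at this
    exact EReal.coe_ne_top _ (top_le_iff.1 this)
  obtain ⟨b, hb⟩ : ∃ b : ℝ, h x = b := ⟨_, (EReal.coe_toReal hxtop (hhnbot x)).symm⟩
  have hopt' (t : E) (s : ℝ) (hts : h t ≤ s) :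
      L / 2 * ‖x - z‖ ^ 2 + b ≤ ε + (L / 2 * ‖t - z‖ ^ 2 + s) := by
    have := hopt t s hts
    rw [hb] at this
    exact_mod_cast this
  obtain ⟨p, r, hp, hmin⟩ := exists_proximal_minimizer hhconv hhlsc hL (z := z) hb.le
    (c := L / 2 * ‖x - z‖ ^ 2 + b - ε) (fun t s hts => by linarith [hopt' t s hts])
  have hsub {t : E} {s : ℝ} (hts : h t ≤ s) := proximal_minimizer_subgradient hhconv hp hmin hts
  have hgap : b - ε + L / 2 * ‖p - x‖ ^ 2 ≤ r + L * ⟪z - p, x - p⟫ := by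
    have hpx := hopt' p r hp
    have hsplit : x - z = (x - p) - (z - p) := by abel
    rw [hsplit, norm_sub_sq_real, norm_sub_rev p z, real_inner_comm] at hpx
    rw [norm_sub_rev p x]
    linarith
  refine ⟨b, hb, p - x, Real.le_sqrt_of_sq_le ?_, fun t s hts => ?_⟩
  · rw [le_div_iff₀ hL]
    linarith [hsub hb.le]
  · have hsplit : z - x - (p - x) = z - p := by abel
    have hdiff : t - x = (t - p) - (x - p) := by abel
    rw [hsplit, hdiff, inner_sub_right]
    nlinarith [hsub hts, mul_nonneg hL.le (sq_nonneg ‖p - x‖)]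

/-- The one-step estimate of the inexact proximal-gradient method at `y`, compared with an
arbitrary point `t`. -/
theorem IsEpsOptimal.proximal_gradient_step {L : ℝ} (hL : 0 < L) {g : E → ℝ} {g' : E → E}
    (hgconv : ConvexOn ℝ Set.univ g) (hgrad : ∀ w, HasGradientAt g (g' w) w)
    (hlip : ∀ w w', ‖g' w - g' w'‖ ≤ L * ‖w - w'‖) {h : E → EReal} (hhconv : ERealConvexOn h)
    (hhlsc : LowerSemicontinuous h) (hhproper : ∃ w, h w ≠ ⊤) (hhnbot : ∀ w, h w ≠ ⊥)
    {ε : ℝ} {x y e : E} (hx : IsEpsOptimal L h ε (y - (1 / L) • (g' y + e)) x) :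
    ∃ b : ℝ, h x = b ∧ ∃ q : E, ‖q‖ ≤ Real.sqrt (2 * ε / L) ∧
      ∀ (t : E) (s : ℝ), h t ≤ s → g x + b + L / 2 * ‖t - x‖ ^ 2 ≤
        g t + s + L / 2 * ‖t - y‖ ^ 2 + ε + ⟪e + L • q, t - x⟫ := by
  obtain ⟨b, hb, q, hq, hsub⟩ := hx.exists_epsSubgradient hhconv hhlsc hhproper hhnbot hL
  refine ⟨b, hb, q, hq, fun t s hts => ?_⟩
  have hh := hsub t s hts
  have hup := le_quadratic_of_lipschitz_gradient hgrad hlip y x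
  have hlow := hgconv.add_inner_gradient_le (hgrad y) t
  have hlin : L * ⟪y - (1 / L) • (g' y + e) - x - q, t - x⟫
      = - L * ⟪t - x, x - y⟫ - ⟪g' y, t - x⟫ - ⟪e + L • q, t - x⟫ := by
    rw [real_inner_comm (x - y) (t - x), ← real_inner_smul_left, ← real_inner_smul_left,
      ← inner_sub_left, ← inner_sub_left]
    congr 1
    rw [smul_sub, smul_sub, smul_sub, smul_smul, mul_one_div_cancel hL.ne']
    module
  have hsplit : t - y = (t - x) + (x - y) := by abel
  rw [hsplit, inner_add_right] at hlow
  rw [hsplit, norm_add_sq_real]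
  linarith

theorem stmt_8
    (L : ℝ) (hL : 0 < L)
    (g : E → ℝ) (g' : E → E)
    (hgconv : ConvexOn ℝ Set.univ g)
    (hgrad : ∀ w, HasGradientAt g (g' w) w)
    (hlip : ∀ w w', ‖g' w - g' w'‖ ≤ L * ‖w - w'‖)
    (h : E → EReal)
    (hhconv : ERealConvexOn h)
    (hhlsc : LowerSemicontinuous h)
    (hhproper : ∃ w, h w ≠ ⊤) (hhnbot : ∀ w, h w ≠ ⊥)
    (f : E → EReal) (hf : ∀ w, f w = ((g w : ℝ) : EReal) + h w)
    (xstar : E) (hmin : ∀ w, f xstar ≤ f w)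
    (x y e : ℕ → E) (ε : ℕ → ℝ) (hεnn : ∀ k, 0 ≤ ε k)
    (hy0 : y 0 = x 0)
    (hy : ∀ k, 1 ≤ k → y k = x k + (((k : ℝ) - 1) / ((k : ℝ) + 2)) • (x k - x (k - 1)))
    (hstep : ∀ k, 1 ≤ k →
      IsEpsOptimal L h (ε k) (y (k - 1) - (1 / L) • (g' (y (k - 1)) + e k)) (x k))
    (θ : ℕ → ℝ) (hθ : ∀ k, θ k = 2 / ((k : ℝ) + 1))
    (v : ℕ → E) (hv : ∀ k, v k = x (k - 1) + (1 / θ k) • (x k - x (k - 1)))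
    :
    ∀ k, 1 ≤ k → ∃ fk : E, ‖fk‖ ≤ Real.sqrt (2 * ε k / L) ∧
      ((1 / θ k ^ 2 : ℝ) : EReal) * (f (x k) - f xstar) +
          ((L / 2 * ‖v k - xstar‖ ^ 2 : ℝ) : EReal) ≤
        (((1 - θ k) / θ k ^ 2 : ℝ) : EReal) * (f (x (k - 1)) - f xstar) +
          ((L / 2 * ‖v (k - 1) - xstar‖ ^ 2 + ε k / θ k ^ 2 +
            (1 / θ k) * ⟪e k + L • fk, xstar - v k⟫ : ℝ) : EReal) := by
  intro k hk
  obtain ⟨b, hb, q, hq, hstepk⟩ := (hstep k hk).proximal_gradient_step hL hgconv hgrad hlip hhconv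
    hhlsc hhproper hhnbot
  refine ⟨q, hq, ?_⟩
  have hstar : h xstar ≠ ⊤ := fun htop => by
    obtain ⟨w, hw⟩ := hhproper
    have := hmin w
    rw [hf, hf, htop, EReal.coe_add_top, top_le_iff] at this
    exact EReal.add_ne_top (EReal.coe_ne_top _) hw this
  obtain ⟨c, hc⟩ : ∃ c : ℝ, h xstar = c := ⟨_, (EReal.coe_toReal hstar (hhnbot _)).symm⟩
  have hk1 : (1 : ℝ) ≤ k := by exact_mod_cast hk
  have hθpos : 0 < θ k := by rw [hθ]; positivity
  have hθle : θ k ≤ 1 := by rw [hθ, div_le_one (by linarith)]; linarith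
  set T := (1 - θ k) • x (k - 1) + θ k • xstar with hT
  have hTx : T - x k = θ k • (xstar - v k) := by
    rw [hv, smul_sub, smul_add, smul_smul, mul_one_div_cancel hθpos.ne', hT]
    module
  have hTy : T - y (k - 1) = θ k • (xstar - v (k - 1)) := by
    rcases hk.eq_or_lt with rfl | hk2
    · have hθ1 : θ 1 = 1 := by rw [hθ]; norm_num
      simp [hT, hθ1, hv 0, hy0]
    · have hcast : ((k - 1 : ℕ) : ℝ) = (k : ℝ) - 1 := by push_cast [hk]; ring
      have hcoef : (1 / θ (k - 1)) * θ k = θ k + ((k : ℝ) - 1 - 1) / ((k : ℝ) - 1 + 2) := by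
        rw [hθ, hθ, hcast, sub_add_cancel, show (k : ℝ) - 1 + 2 = k + 1 by ring]
        field_simp
        ring
      rw [hy (k - 1) (by omega), hv (k - 1), hcast, hT, smul_sub (θ k), smul_add (θ k), smul_smul,
        mul_comm (θ k) (1 / θ (k - 1)), hcoef]
      module
  obtain ⟨a, s, hTs, hgap, hprev⟩ : ∃ a s : ℝ, h T ≤ s ∧
      g T + s ≤ (1 - θ k) * a + θ k * (g xstar + c) ∧
      (((1 - θ k) / θ k ^ 2 : ℝ) : EReal) * (f (x (k - 1)) - f xstar) =
        (((1 - θ k) / θ k ^ 2 * (a - (g xstar + c)) : ℝ) : EReal) := by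
    rcases hk.eq_or_lt with rfl | hk2
    · have hθ1 : θ 1 = 1 := by rw [hθ]; norm_num
      have hTstar : T = xstar := by simp [hT, hθ1]
      exact ⟨0, c, by rw [hTstar, hc], by simp [hTstar, hθ1], by simp [hθ1]⟩
    · obtain ⟨b', hb', -⟩ := (hstep (k - 1) (by omega)).exists_epsSubgradient hhconv hhlsc hhproper
        hhnbot hL
      refine ⟨g (x (k - 1)) + b', _, hhconv.le_coe_of_le_coe hb'.le hc.le (sub_nonneg.2 hθle)
        hθpos.le (sub_add_cancel _ _), ?_, ?_⟩
      · have := hgconv.2 (Set.mem_univ (x (k - 1))) (Set.mem_univ xstar) (sub_nonneg.2 hθle)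
          hθpos.le (sub_add_cancel _ _)
        simp only [smul_eq_mul, ← hT] at this
        linarith
      · rw [hf, hf, hb', hc]
        norm_cast
  have hmain := hstepk T s hTs
  rw [hTx, hTy, norm_smul, norm_smul, Real.norm_of_nonneg hθpos.le, real_inner_smul_right] at hmain
  rw [hprev, hf, hf, hb, hc]
  norm_cast
  rw [norm_sub_rev (v k), norm_sub_rev (v (k - 1))]
  have hscaled : (g (x k) + b + L / 2 * (θ k * ‖xstar - v k‖) ^ 2) / θ k ^ 2 ≤
      ((1 - θ k) * a + θ k * (g xstar + c) + L / 2 * (θ k * ‖xstar - v (k - 1)‖) ^ 2 + ε k +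
        θ k * ⟪e k + L • q, xstar - v k⟫) / θ k ^ 2 :=
    div_le_div_of_nonneg_right (by linarith) (sq_nonneg (θ k))
  rw [← sub_nonneg] at hscaled ⊢
  refine hscaled.trans_eq ?_
  field_simp
  ring
end
end

section
/- Assume g is μ-strongly convex with 0 < μ ≤ L. Suppose x_prev ∈ E, e ∈ E, ε ≥ 0, and x is an ε-optimal solution of the proximal problem at x_prev − (1/L)(g'(x_prev) + e). Then ‖x − x*‖ ≤ (1 − μ/L)‖x_prev − x*‖ + ‖e‖/L + √(2ε/L). -/
open scoped RealInnerProductSpace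
open Finset

noncomputable section

variable {E : Type*} [NormedAddCommGroup E] [InnerProductSpace ℝ E] [CompleteSpace E]

/-- The descent lemma for a function with Lipschitz continuous gradient. -/
theorem descent_of_lipschitz_gradient {L : ℝ} {g : E → ℝ} {g' : E → E}
    (hgrad : ∀ w, HasGradientAt g (g' w) w)
    (hlip : ∀ w w', ‖g' w - g' w'‖ ≤ L * ‖w - w'‖) (x d : E) :
    g (x + d) ≤ g x + ⟪g' x, d⟫ + L / 2 * ‖d‖ ^ 2 := by
  set k : ℝ → ℝ := fun t => g (x + t • d) - t * ⟪g' x, d⟫ - L / 2 * ‖d‖ ^ 2 * t ^ 2 with hk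
  have hderiv (t : ℝ) : HasDerivAt k
      (⟪g' (x + t • d), d⟫ - ⟪g' x, d⟫ - L * ‖d‖ ^ 2 * t) t := by
    have hline : HasDerivAt (fun t : ℝ => x + t • d) d t := by
      simpa using ((hasDerivAt_id t).smul_const d).const_add x
    have hcomp := (hgrad (x + t • d)).hasFDerivAt.comp_hasDerivAt t hline
    have hlin := (hasDerivAt_id t).mul_const ⟪g' x, d⟫
    have hsq := ((hasDerivAt_id t).pow 2).const_mul (L / 2 * ‖d‖ ^ 2)
    refine ((hcomp.sub hlin).sub hsq).congr_deriv ?_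
    simp only [InnerProductSpace.toDual_apply_apply, id_eq]
    push_cast
    ring
  have hanti : AntitoneOn k (Set.Icc 0 1) := by
    refine antitoneOn_of_deriv_nonpos (convex_Icc 0 1)
      (fun t _ => (hderiv t).continuousAt.continuousWithinAt)
      (fun t _ => (hderiv t).differentiableAt.differentiableWithinAt) fun t ht => ?_
    rw [interior_Icc] at ht
    rw [(hderiv t).deriv, ← inner_sub_left]
    have hcs := real_inner_le_norm (g' (x + t • d) - g' x) d
    have hl := hlip (x + t • d) x
    rw [add_sub_cancel_left, norm_smul, Real.norm_of_nonneg ht.1.le] at hl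
    nlinarith [mul_le_mul_of_nonneg_right hl (norm_nonneg d)]
  have h01 := hanti (Set.left_mem_Icc.2 zero_le_one) (Set.right_mem_Icc.2 zero_le_one) zero_le_one
  simp only [hk, one_smul, zero_smul, add_zero] at h01
  linarith

/-- Interpolation inequality for a strongly convex function with Lipschitz gradient. -/
theorem inner_gradient_sub_ge {L μ : ℝ} {g : E → ℝ} {g' : E → E}
    (hgrad : ∀ w, HasGradientAt g (g' w) w)
    (hlip : ∀ w w', ‖g' w - g' w'‖ ≤ L * ‖w - w'‖)
    (hsc : ∀ w w', g w + ⟪g' w, w' - w⟫ + μ / 2 * ‖w' - w‖ ^ 2 ≤ g w')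
    (x y : E) (c : ℝ) :
    (2 * c - (L - μ) * c ^ 2) * ‖g' y - g' x - μ • (y - x)‖ ^ 2 ≤
      ⟪g' y - g' x - μ • (y - x), y - x⟫ := by
  set H : E := g' y - g' x - μ • (y - x) with hH
  have hg : g' y = g' x + μ • (y - x) + H := by rw [hH]; abel
  have hdown := descent_of_lipschitz_gradient hgrad hlip y (-(c • H))
  have hup := descent_of_lipschitz_gradient hgrad hlip x (c • H)
  have hscx := hsc x (y + -(c • H))
  have hscy := hsc y (x + c • H)
  rw [show y + -(c • H) - x = (y - x) - c • H by abel, norm_sub_sq_real] at hscx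
  rw [show x + c • H - y = c • H - (y - x) by abel, norm_sub_sq_real] at hscy
  rw [hg] at hdown hscy
  simp only [inner_add_left, inner_sub_right, inner_neg_right, inner_smul_right,
    real_inner_smul_left, norm_neg, norm_smul, mul_pow, Real.norm_eq_abs, sq_abs,
    real_inner_self_eq_norm_sq, inner_sub_left, real_inner_comm, norm_sub_sq_real] at *
  linarith

/-- Cocoercivity of the gradient of a strongly convex function with Lipschitz gradient. -/
theorem sq_norm_gradient_sub_le {L μ : ℝ} (hμL : μ ≤ L) {g : E → ℝ} {g' : E → E}
    (hgrad : ∀ w, HasGradientAt g (g' w) w)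
    (hlip : ∀ w w', ‖g' w - g' w'‖ ≤ L * ‖w - w'‖)
    (hsc : ∀ w w', g w + ⟪g' w, w' - w⟫ + μ / 2 * ‖w' - w‖ ^ 2 ≤ g w')
    (x y : E) :
    ‖g' y - g' x - μ • (y - x)‖ ^ 2 ≤ (L - μ) * ⟪g' y - g' x - μ • (y - x), y - x⟫ := by
  have key := inner_gradient_sub_ge hgrad hlip hsc x y
  generalize g' y - g' x - μ • (y - x) = H at key ⊢
  rcases hμL.eq_or_lt with rfl | hlt
  · have h0 := key 0
    rcases (sq_nonneg ‖H‖).eq_or_lt with hz | hpos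
    · simp [← hz]
    · have h1 := key ((⟪H, y - x⟫ + 1) / ‖H‖ ^ 2)
      have h2 : (⟪H, y - x⟫ + 1) / ‖H‖ ^ 2 * ‖H‖ ^ 2 = ⟪H, y - x⟫ + 1 :=
        div_mul_cancel₀ _ hpos.ne'
      nlinarith
  · have hM : 0 < L - μ := sub_pos.2 hlt
    have h1 := mul_le_mul_of_nonneg_left (key (1 / (L - μ))) hM.le
    refine le_of_eq_of_le ?_ h1
    field_simp
    ring

/-- A gradient step with step size `1 / L` is a contraction with factor `1 - μ / L`. -/
theorem norm_gradient_step_sub_le {L μ : ℝ} (hμ : 0 < μ) (hμL : μ ≤ L) {g : E → ℝ} {g' : E → E}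
    (hgrad : ∀ w, HasGradientAt g (g' w) w)
    (hlip : ∀ w w', ‖g' w - g' w'‖ ≤ L * ‖w - w'‖)
    (hsc : ∀ w w', g w + ⟪g' w, w' - w⟫ + μ / 2 * ‖w' - w‖ ^ 2 ≤ g w')
    (x y : E) :
    ‖(y - x) - (1 / L) • (g' y - g' x)‖ ≤ (1 - μ / L) * ‖y - x‖ := by
  have hL : 0 < L := hμ.trans_le hμL
  have hco := sq_norm_gradient_sub_le hμL hgrad hlip hsc x y
  set H : E := g' y - g' x - μ • (y - x) with hH
  have hstep : (y - x) - (1 / L) • (g' y - g' x) = (1 / L) • ((L - μ) • (y - x) - H) := by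
    rw [hH]
    match_scalars <;> field_simp <;> ring
  have hnorm : ‖(L - μ) • (y - x) - H‖ ≤ (L - μ) * ‖y - x‖ := by
    refine le_of_sq_le_sq ?_ (mul_nonneg (sub_nonneg.2 hμL) (norm_nonneg _))
    rw [norm_sub_sq_real, real_inner_smul_left, real_inner_comm, norm_smul, Real.norm_eq_abs,
      mul_pow, mul_pow, sq_abs]
    nlinarith [sq_nonneg ‖H‖]
  rw [hstep, norm_smul, Real.norm_of_nonneg (by positivity)]
  calc 1 / L * ‖(L - μ) • (y - x) - H‖ ≤ 1 / L * ((L - μ) * ‖y - x‖) := by gcongr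
    _ = (1 - μ / L) * ‖y - x‖ := by field_simp

omit [CompleteSpace E] in
/-- Real-valued form of convexity at two points where the function is finite. -/
theorem ERealConvexOn.exists_coe_le {h : E → EReal} (hconv : ERealConvexOn h)
    (hbot : ∀ w, h w ≠ ⊥) {x d : E} {r s t : ℝ} (hx : h x = r) (hd : h (x + d) = s)
    (ht0 : 0 ≤ t) (ht1 : t ≤ 1) :
    ∃ v : ℝ, h (x + t • d) = v ∧ v ≤ (1 - t) * r + t * s := by
  have hle := hconv x (x + d) (1 - t) t (sub_nonneg.2 ht1) ht0 (by ring)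
  rw [show (1 - t) • x + t • (x + d) = x + t • d by module, hx, hd,
    ← EReal.coe_mul, ← EReal.coe_mul, ← EReal.coe_add] at hle
  have htop : h (x + t • d) ≠ ⊤ := (hle.trans_lt (EReal.coe_lt_top _)).ne
  lift h (x + t • d) to ℝ using ⟨htop, hbot _⟩ with v
  exact ⟨v, rfl, EReal.coe_le_coe_iff.1 hle⟩

/-- First-order optimality condition for the composite problem. -/
theorem le_add_inner_gradient_of_isMin {L : ℝ} {g : E → ℝ} {g' : E → E}
    (hgrad : ∀ w, HasGradientAt g (g' w) w)
    (hlip : ∀ w w', ‖g' w - g' w'‖ ≤ L * ‖w - w'‖) {h : E → EReal}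
    (hconv : ERealConvexOn h) (hbot : ∀ w, h w ≠ ⊥) {x d : E} {r s : ℝ}
    (hmin : ∀ w, ((g x : ℝ) : EReal) + h x ≤ ((g w : ℝ) : EReal) + h w)
    (hx : h x = r) (hd : h (x + d) = s) :
    r ≤ s + ⟪g' x, d⟫ := by
  have hsmall (t : ℝ) (ht0 : 0 < t) (ht1 : t ≤ 1) :
      r - s - ⟪g' x, d⟫ ≤ t * (L / 2 * ‖d‖ ^ 2) := by
    obtain ⟨v, hv, hvle⟩ := hconv.exists_coe_le hbot hx hd ht0.le ht1
    have hm := hmin (x + t • d)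
    rw [hx, hv] at hm
    norm_cast at hm
    have hdes := descent_of_lipschitz_gradient hgrad hlip x (t • d)
    rw [inner_smul_right, norm_smul, mul_pow, Real.norm_eq_abs, sq_abs] at hdes
    refine le_of_mul_le_mul_left ?_ ht0
    nlinarith
  have hlim : Filter.Tendsto (fun t : ℝ => t * (L / 2 * ‖d‖ ^ 2)) (nhdsWithin 0 (Set.Ioi 0))
      (nhds 0) := by
    have hcont : Continuous fun t : ℝ => t * (L / 2 * ‖d‖ ^ 2) := by fun_prop
    simpa using (hcont.tendsto 0).mono_left nhdsWithin_le_nhds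
  have hle : r - s - ⟪g' x, d⟫ ≤ 0 := by
    refine ge_of_tendsto hlim ?_
    filter_upwards [Ioc_mem_nhdsGT (zero_lt_one' ℝ)] with t ht using hsmall t ht.1 ht.2
  linarith

omit [CompleteSpace E] in
/-- An `ε`-optimal proximal point is within `‖y - u‖ + √(2ε / L)` of the exact proximal point `p`
at `u`, the latter being characterized by its variational inequality. -/
theorem IsEpsOptimal.norm_sub_le {L : ℝ} (hL : 0 < L) {h : E → EReal}
    (hconv : ERealConvexOn h) (hbot : ∀ w, h w ≠ ⊥) {ε : ℝ} {y u x p : E} {r s : ℝ}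
    (hopt : IsEpsOptimal L h ε y x) (hx : h x = s) (hp : h p = r)
    (hsub : r + L * ⟪u - p, x - p⟫ ≤ s) :
    ‖x - p‖ ≤ ‖y - u‖ + Real.sqrt (2 * ε / L) := by
  rcases le_or_gt ‖x - p‖ ‖y - u‖ with hle | hlt
  · exact hle.trans (le_add_of_nonneg_right (Real.sqrt_nonneg _))
  set D := ‖x - p‖ with hD
  set a := ‖y - u‖
  have ha0 : 0 ≤ a := norm_nonneg _
  have hD0 : 0 < D := ha0.trans_lt hlt
  have hineq (t : ℝ) (ht0 : 0 ≤ t) (ht1 : t ≤ 1) :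
      L * (t * (D ^ 2 - a * D) - t ^ 2 / 2 * D ^ 2) ≤ ε := by
    obtain ⟨v, hv, hvle⟩ := hconv.exists_coe_le hbot (d := p - x) hx
      (by rw [add_sub_cancel, hp]) ht0 ht1
    have ho : proxObj L h y x ≤ (ε : EReal) + proxObj L h y (x + t • (p - x)) :=
      hopt.trans (by gcongr; exact iInf_le _ _)
    rw [proxObj, proxObj, hx, hv] at ho
    norm_cast at ho
    rw [show x + t • (p - x) - y = (x - y) - t • (x - p) by module,
      norm_sub_sq_real (x - y) (t • (x - p)), inner_smul_right, norm_smul, mul_pow, Real.norm_eq_abs, sq_abs, ← hD] at ho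
    have hsplit : ⟪x - y, x - p⟫ + ⟪u - p, x - p⟫ = D ^ 2 - ⟪y - u, x - p⟫ := by
      rw [hD, ← real_inner_self_eq_norm_sq, ← inner_add_left, ← inner_sub_left]
      congr 1
      abel
    have hcs : ⟪y - u, x - p⟫ ≤ a * D := real_inner_le_norm _ _
    have hLt : 0 ≤ L * t := mul_nonneg hL.le ht0
    have h1 := mul_le_mul_of_nonneg_left hcs hLt
    have h2 := mul_le_mul_of_nonneg_left hsub ht0
    have h3 : L * t * (⟪x - y, x - p⟫ + ⟪u - p, x - p⟫) = L * t * (D ^ 2 - ⟪y - u, x - p⟫) := by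
      rw [hsplit]
    linarith
  have hbest := hineq ((D - a) / D) (div_nonneg (sub_nonneg.2 hlt.le) hD0.le)
    ((div_le_one hD0).2 (sub_le_self _ ha0))
  have hval : (D - a) / D * (D ^ 2 - a * D) - ((D - a) / D) ^ 2 / 2 * D ^ 2 = (D - a) ^ 2 / 2 := by
    field_simp
    ring
  rw [hval] at hbest
  have hsqrt : D - a ≤ Real.sqrt (2 * ε / L) := by
    refine Real.le_sqrt_of_sq_le ?_
    rw [le_div_iff₀ hL]
    linarith
  linarith

theorem stmt_13
    (L μ : ℝ) (hμ : 0 < μ) (hμL : μ ≤ L)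
    (g : E → ℝ) (g' : E → E)
    (hgrad : ∀ w, HasGradientAt g (g' w) w)
    (hlip : ∀ w w', ‖g' w - g' w'‖ ≤ L * ‖w - w'‖)
    (hsc : ∀ w w', g w + ⟪g' w, w' - w⟫ + μ / 2 * ‖w' - w‖ ^ 2 ≤ g w')
    (h : E → EReal)
    (hhconv : ERealConvexOn h)
    (hhlsc : LowerSemicontinuous h)
    (hhproper : ∃ w, h w ≠ ⊤) (hhnbot : ∀ w, h w ≠ ⊥)
    (f : E → EReal) (hf : ∀ w, f w = ((g w : ℝ) : EReal) + h w)
    (xstar : E) (hmin : ∀ w, f xstar ≤ f w)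
    (xprev e : E) (ε : ℝ) (hε : 0 ≤ ε) (xx : E)
    (hopt : IsEpsOptimal L h ε (xprev - (1 / L) • (g' xprev + e)) xx) :
    ‖xx - xstar‖ ≤ (1 - μ / L) * ‖xprev - xstar‖ + ‖e‖ / L + Real.sqrt (2 * ε / L) := by
  have hL : 0 < L := hμ.trans_le hμL
  obtain ⟨w, hw⟩ := hhproper
  simp only [hf] at hmin
  have hstar_top : h xstar ≠ ⊤ := by
    intro htop
    have hm := hmin w
    lift h w to ℝ using ⟨hw, hhnbot w⟩ with q
    rw [htop, EReal.coe_add_top, top_le_iff] at hm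
    exact EReal.coe_ne_top (g w + q) (by exact_mod_cast hm)
  obtain ⟨r, hr⟩ : ∃ r : ℝ, h xstar = r := ⟨_, (EReal.coe_toReal hstar_top (hhnbot _)).symm⟩
  have hx_top : h xx ≠ ⊤ := by
    intro htop
    have ho := hopt.trans (add_le_add_right (iInf_le _ xstar) _)
    simp only [proxObj] at ho
    rw [htop, hr, EReal.coe_add_top, top_le_iff] at ho
    exact EReal.coe_ne_top _ (by exact_mod_cast ho)
  obtain ⟨s, hs⟩ : ∃ s : ℝ, h xx = s := ⟨_, (EReal.coe_toReal hx_top (hhnbot _)).symm⟩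
  have hfirst := le_add_inner_gradient_of_isMin hgrad hlip hhconv hhnbot (d := xx - xstar) hmin hr
    (by rw [add_sub_cancel, hs])
  have hdist := hopt.norm_sub_le hL hhconv hhnbot (u := xstar - (1 / L) • g' xstar) hs hr (by
    rw [sub_sub_cancel_left, inner_neg_left, real_inner_smul_left, mul_neg, ← mul_assoc,
      mul_one_div_cancel hL.ne']
    linarith)
  have hstep := norm_gradient_step_sub_le hμ hμL hgrad hlip hsc xstar xprev
  have htri : ‖xprev - (1 / L) • (g' xprev + e) - (xstar - (1 / L) • g' xstar)‖ ≤
      ‖(xprev - xstar) - (1 / L) • (g' xprev - g' xstar)‖ + ‖e‖ / L := by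
    rw [show xprev - (1 / L) • (g' xprev + e) - (xstar - (1 / L) • g' xstar) =
      ((xprev - xstar) - (1 / L) • (g' xprev - g' xstar)) - (1 / L) • e by module]
    refine (norm_sub_le _ _).trans_eq ?_
    rw [norm_smul, Real.norm_of_nonneg (by positivity), one_div_mul_eq_div]
  linarith
end
end
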